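/- There exists a universal constant C > 0 with the following property. Let K ⊂ ℝⁿ be a centrally symmetric convex body of volume 1 which is 2-convex with constant α > 0. Then ∫_K |x| dx ≤ C·M*(K)/√α, where |·| is the Euclidean norm. -/

import Mathlib

open MeasureTheory
open scoped RealInnerProductSpace

noncomputable section

/-- A centrally symmetric convex body: compact, convex, with nonempty interior,
and symmetric about the origin. -/
def IsSymmConvexBody {E : Type*} [NormedAddCommGroup E] [NormedSpace ℝ E]
    (K : Set E) : Prop :=
  IsCompact K ∧ Convex ℝ K ∧ (interior K).Nonempty ∧ K = -K

/-- The modulus of convexity of `K`, defined via the gauge (Minkowski functional) of `K`. -/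
def modulusOfConvexity {E : Type*} [AddCommGroup E] [Module ℝ E]
    (K : Set E) (ε : ℝ) : ℝ :=
  sInf { d | ∃ x y : E, gauge K x ≤ 1 ∧ gauge K y ≤ 1 ∧ ε ≤ gauge K (x - y) ∧
    d = 1 - gauge K ((2:ℝ)⁻¹ • (x + y)) }

/-- `K` is 2-convex with constant `α`: `δ_K(ε) ≥ α ε²` for all `0 < ε ≤ 2`. -/
def IsTwoConvex {E : Type*} [AddCommGroup E] [Module ℝ E]
    (K : Set E) (α : ℝ) : Prop :=
  ∀ ε : ℝ, 0 < ε → ε ≤ 2 → α * ε ^ 2 ≤ modulusOfConvexity K ε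

/-- The dual norm `‖θ‖*_K = sup_{y ∈ K} ⟨θ, y⟩`. -/
def dualNorm {n : ℕ} (K : Set (EuclideanSpace ℝ (Fin n)))
    (θ : EuclideanSpace ℝ (Fin n)) : ℝ :=
  sSup ((fun y => ⟪θ, y⟫) '' K)

/-- The `ψ₂`-norm of the linear functional `⟨·, θ⟩` w.r.t. the uniform measure on `K`:
`inf { λ > 0 : (1/|K|) ∫_K exp(⟨x,θ⟩²/λ²) dx ≤ 2 }`. -/
def psiTwoNorm {n : ℕ} (K : Set (EuclideanSpace ℝ (Fin n)))
    (θ : EuclideanSpace ℝ (Fin n)) : ℝ :=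
  sInf { l : ℝ | 0 < l ∧
    (volume K).toReal⁻¹ * ∫ x in K, Real.exp (⟪x, θ⟫ ^ 2 / l ^ 2) ≤ 2 }

/-- The uniform (rotation-invariant) probability measure on the unit sphere `S^{n-1}`,
realized as the normalized `(n-1)`-dimensional Hausdorff measure on the sphere. -/
def sphereMeasure (n : ℕ) : Measure (EuclideanSpace ℝ (Fin n)) :=
  (μH[(n : ℝ) - 1] (Metric.sphere (0 : EuclideanSpace ℝ (Fin n)) 1))⁻¹ •
    (μH[(n : ℝ) - 1]).restrict (Metric.sphere (0 : EuclideanSpace ℝ (Fin n)) 1)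

/-- The mean-width parameter `M*(K) = ∫_{S^{n-1}} ‖θ‖*_K dσ(θ)`. -/
def MStar {n : ℕ} (K : Set (EuclideanSpace ℝ (Fin n))) : ℝ :=
  ∫ θ, dualNorm K θ ∂(sphereMeasure n)

section PrekopaLeindler

open scoped ENNReal

lemma volume_add_volume_le_of_isCompact {A B C : Set ℝ} (hA : IsCompact A) (hB : IsCompact B)
    (hA' : A.Nonempty) (hB' : B.Nonempty) (h : ∀ x ∈ A, ∀ y ∈ B, (x + y) / 2 ∈ C) :
    volume A + volume B ≤ 2 * volume C := by
  obtain ⟨a, haA, ha⟩ := hA.exists_isGreatest hA'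
  obtain ⟨b, hbB, hb⟩ := hB.exists_isLeast hB'
  have hD : volume ((fun x : ℝ => 2⁻¹ * x) ⁻¹' C) = 2 * volume C := by
    rw [Real.volume_preimage_mul_left (by norm_num)]
    norm_num
  have h1 : volume ((fun x => x + b) '' A) = volume A := by simp
  have h2 : volume ((fun x => a + x) '' B) = volume B := by simp
  have hm : MeasurableSet ((fun x => a + x) '' B) :=
    (hB.image (by fun_prop)).measurableSet
  have hdisj : AEDisjoint volume ((fun x => x + b) '' A) ((fun x => a + x) '' B) := by
    refine measure_mono_null (t := {a + b}) ?_ (by simp)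
    rintro _ ⟨⟨x, hx, rfl⟩, ⟨y, hy, hxy⟩⟩
    have := ha hx
    have := hb hy
    simp only at hxy
    simp only [Set.mem_singleton_iff]
    linarith
  rw [← hD, ← h1, ← h2, ← measure_union₀ hm.nullMeasurableSet hdisj]
  refine measure_mono ?_
  rintro _ (⟨x, hx, rfl⟩ | ⟨y, hy, rfl⟩)
  · have := h x hx b hbB
    rwa [div_eq_inv_mul] at this
  · have := h a haA y hy
    rwa [div_eq_inv_mul] at this

/-- The Brunn–Minkowski inequality on the line. -/
lemma volume_add_volume_le_of_midpoint_mem {A B C : Set ℝ} (hA : MeasurableSet A)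
    (hB : MeasurableSet B) (hA' : A.Nonempty) (hB' : B.Nonempty)
    (h : ∀ x ∈ A, ∀ y ∈ B, (x + y) / 2 ∈ C) :
    volume A + volume B ≤ 2 * volume C := by
  obtain ⟨a, ha⟩ := hA'
  obtain ⟨b, hb⟩ := hB'
  rw [hA.measure_eq_iSup_isCompact, hB.measure_eq_iSup_isCompact]
  simp only [iSup_and']
  refine ENNReal.biSup_add_biSup_le' ⟨∅, by simp⟩ ⟨∅, by simp⟩ ?_
  rintro K ⟨hKA, hK⟩ L ⟨hLB, hL⟩
  refine le_trans (add_le_add (measure_mono (Set.subset_insert a K))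
    (measure_mono (Set.subset_insert b L))) ?_
  refine volume_add_volume_le_of_isCompact (hK.insert a) (hL.insert b) ⟨a, by simp⟩ ⟨b, by simp⟩ ?_
  intro x hx y hy
  exact h x (Set.insert_subset ha hKA hx) y (Set.insert_subset hb hLB hy)

lemma lintegral_eq_lintegral_Ioo_meas_lt {f : ℝ → ℝ≥0∞} (hf : Measurable f) (h1 : ∀ x, f x ≤ 1) :
    ∫⁻ x, f x = ∫⁻ t in Set.Ioo (0 : ℝ) 1, volume {x | ENNReal.ofReal t < f x} := by
  have hfin : ∀ x, f x ≠ ∞ := fun x => ne_top_of_le_ne_top (by simp) (h1 x)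
  have key := lintegral_eq_lintegral_meas_lt volume (f := fun x => (f x).toReal)
    (Filter.Eventually.of_forall fun x => ENNReal.toReal_nonneg) hf.ennreal_toReal.aemeasurable
  simp only [ENNReal.ofReal_toReal (hfin _)] at key
  rw [key, ← lintegral_indicator measurableSet_Ioi, ← lintegral_indicator measurableSet_Ioo]
  refine lintegral_congr fun t => ?_
  by_cases ht : t ∈ Set.Ioo (0 : ℝ) 1
  · rw [Set.indicator_of_mem (Set.mem_Ioi.2 ht.1), Set.indicator_of_mem ht]
    simp only [ENNReal.ofReal_lt_iff_lt_toReal ht.1.le (hfin _)]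
  · rw [Set.indicator_of_notMem ht]
    refine Set.indicator_apply_eq_zero.2 fun ht0 => ?_
    have ht1 : (1 : ℝ) ≤ t := not_lt.1 fun hlt => ht ⟨ht0, hlt⟩
    have he : {x | t < (f x).toReal} = ∅ := by
      ext x
      have : (f x).toReal ≤ 1 := ENNReal.toReal_le_of_le_ofReal (by simp) (by simpa using h1 x)
      simp only [Set.mem_ofPred_eq, Set.mem_empty_iff_false, iff_false, not_lt]
      linarith
    simp [he]

/-- The additive form of the Prékopa–Leindler inequality on the line, for functions of supremum
one. -/
lemma lintegral_add_lintegral_le_of_iSup_eq_one {f g h : ℝ → ℝ≥0∞} (hf : Measurable f)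
    (hg : Measurable g) (hh : Measurable h) (hf1 : ⨆ x, f x = 1) (hg1 : ⨆ x, g x = 1)
    (H : ∀ x y, f x * g y ≤ h ((x + y) / 2) ^ 2) :
    (∫⁻ x, f x) + ∫⁻ x, g x ≤ 2 * ∫⁻ x, h x := by
  have hmin : ∫⁻ x, min (h x) 1 ≤ ∫⁻ x, h x := lintegral_mono fun x => min_le_left _ _
  refine le_trans ?_ (mul_le_mul_right hmin 2)
  have hfle : ∀ x, f x ≤ 1 := fun x => hf1 ▸ le_iSup f x
  have hgle : ∀ x, g x ≤ 1 := fun x => hg1 ▸ le_iSup g x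
  have hm : ∀ u : ℝ → ℝ≥0∞, Measurable fun t : ℝ => volume {x | ENNReal.ofReal t < u x} := by
    intro u
    refine Antitone.measurable fun s t hst => measure_mono fun x hx => ?_
    exact lt_of_le_of_lt (ENNReal.ofReal_le_ofReal hst) hx
  rw [lintegral_eq_lintegral_Ioo_meas_lt hf hfle, lintegral_eq_lintegral_Ioo_meas_lt hg hgle,
    lintegral_eq_lintegral_Ioo_meas_lt (hh.min measurable_const) (fun x => min_le_right _ _),
    ← lintegral_add_left (hm f), ← lintegral_const_mul _ (hm _)]
  refine setLIntegral_mono' measurableSet_Ioo fun t ht => ?_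
  have ht1 : ENNReal.ofReal t < 1 := by
    rw [← ENNReal.ofReal_one]; exact (ENNReal.ofReal_lt_ofReal_iff one_pos).2 ht.2
  refine volume_add_volume_le_of_midpoint_mem (measurableSet_lt measurable_const hf)
    (measurableSet_lt measurable_const hg) ?_ ?_ ?_
  · exact lt_iSup_iff.1 (hf1.symm ▸ ht1)
  · exact lt_iSup_iff.1 (hg1.symm ▸ ht1)
  · intro x hx y hy
    refine lt_min ?_ ht1
    by_contra hle
    have h2 : h ((x + y) / 2) ^ 2 ≤ ENNReal.ofReal t ^ 2 := pow_le_pow_left' (not_lt.1 hle) 2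
    have h3 : ENNReal.ofReal t ^ 2 < f x * g y := by
      rw [sq]; exact ENNReal.mul_lt_mul hx hy
    exact absurd ((H x y).trans h2) (not_le.2 h3)

lemma ENNReal.four_mul_le_sq_add (u v : ℝ≥0∞) : 4 * u * v ≤ (u + v) ^ 2 := by
  rcases eq_or_ne u ∞ with rfl | hu
  · simp
  rcases eq_or_ne v ∞ with rfl | hv
  · simp
  lift u to NNReal using hu
  lift v to NNReal using hv
  have := _root_.four_mul_le_sq_add u v
  exact_mod_cast this

lemma lintegral_mul_lintegral_le_sq_of_bounded {f g h : ℝ → ℝ≥0∞} (hf : Measurable f)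
    (hg : Measurable g) (hh : Measurable h) {M : ℝ≥0∞} (hM : M ≠ ∞) (hfM : ∀ x, f x ≤ M)
    (hgM : ∀ x, g x ≤ M) (H : ∀ x y, f x * g y ≤ h ((x + y) / 2) ^ 2) :
    (∫⁻ x, f x) * ∫⁻ x, g x ≤ (∫⁻ x, h x) ^ 2 := by
  set a := ⨆ x, f x with ha
  set b := ⨆ x, g x with hb
  have hatop : a ≠ ∞ := ne_top_of_le_ne_top hM (iSup_le hfM)
  have hbtop : b ≠ ∞ := ne_top_of_le_ne_top hM (iSup_le hgM)
  rcases eq_or_ne a 0 with ha0 | ha0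
  · have : ∀ x, f x = 0 := fun x => le_antisymm (ha0 ▸ le_iSup f x) (zero_le)
    simp [this]
  rcases eq_or_ne b 0 with hb0 | hb0
  · have : ∀ x, g x = 0 := fun x => le_antisymm (hb0 ▸ le_iSup g x) (zero_le)
    simp [this]
  obtain ⟨c, hc⟩ : ∃ c : ℝ≥0∞, c ^ 2 = a⁻¹ * b⁻¹ :=
    ⟨(a⁻¹ * b⁻¹) ^ (2⁻¹ : ℝ), by rw [← ENNReal.rpow_natCast, ← ENNReal.rpow_mul]; simp⟩
  have key := lintegral_add_lintegral_le_of_iSup_eq_one (f := fun x => a⁻¹ * f x)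
    (g := fun x => b⁻¹ * g x) (h := fun x => c * h x) (hf.const_mul _) (hg.const_mul _)
    (hh.const_mul _) (by rw [← ENNReal.mul_iSup, ← ha, ENNReal.inv_mul_cancel ha0 hatop])
    (by rw [← ENNReal.mul_iSup, ← hb, ENNReal.inv_mul_cancel hb0 hbtop])
    (fun x y => by
      rw [mul_pow, hc, mul_mul_mul_comm]
      gcongr
      exact H x y)
  rw [lintegral_const_mul _ hf, lintegral_const_mul _ hg, lintegral_const_mul _ hh] at key
  have h2 := (ENNReal.four_mul_le_sq_add _ _).trans (pow_le_pow_left' key 2)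
  set F := ∫⁻ x, f x
  set G := ∫⁻ x, g x
  set I := ∫⁻ x, h x
  have h3 : (4 * (a⁻¹ * b⁻¹)) * (F * G) ≤ (4 * (a⁻¹ * b⁻¹)) * I ^ 2 := by
    calc (4 * (a⁻¹ * b⁻¹)) * (F * G) = 4 * (a⁻¹ * F) * (b⁻¹ * G) := by ring
      _ ≤ (2 * (c * I)) ^ 2 := h2
      _ = (4 * (a⁻¹ * b⁻¹)) * I ^ 2 := by rw [← hc]; ring
  refine (ENNReal.mul_le_mul_iff_right ?_ ?_).1 h3
  · simp [hatop, hbtop]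
  · exact ENNReal.mul_ne_top (by simp) (ENNReal.mul_ne_top (by simpa) (by simpa))

/-- The Prékopa–Leindler inequality on the line (for the midpoint). -/
lemma lintegral_mul_lintegral_le_sq {f g h : ℝ → ℝ≥0∞} (hf : Measurable f)
    (hg : Measurable g) (hh : Measurable h) (H : ∀ x y, f x * g y ≤ h ((x + y) / 2) ^ 2) :
    (∫⁻ x, f x) * ∫⁻ x, g x ≤ (∫⁻ x, h x) ^ 2 := by
  have htrunc : ∀ u : ℝ → ℝ≥0∞, Measurable u →
      ∫⁻ x, u x = ⨆ N : ℕ, ∫⁻ x, min (u x) N := by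
    intro u hu
    rw [← lintegral_iSup (fun N => hu.min measurable_const)
      (fun M N hMN x => min_le_min_left _ (by exact_mod_cast hMN))]
    refine lintegral_congr fun x => ?_
    rw [← inf_iSup_eq, ENNReal.iSup_natCast, inf_top_eq]
  rw [htrunc f hf, htrunc g hg, ENNReal.iSup_mul]
  refine iSup_le fun N => ?_
  rw [ENNReal.mul_iSup]
  refine iSup_le fun M => ?_
  refine lintegral_mul_lintegral_le_sq_of_bounded (M := max N M) (hf.min measurable_const)
    (hg.min measurable_const) hh (by simp) (fun x => (min_le_right _ _).trans (le_max_left _ _))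
    (fun x => (min_le_right _ _).trans (le_max_right _ _)) fun x y => ?_
  exact (mul_le_mul' (min_le_left _ _) (min_le_left _ _)).trans (H x y)

/-- The Prékopa–Leindler inequality in `ℝⁿ` (for the midpoint). -/
lemma lintegral_mul_lintegral_le_sq_pi (n : ℕ) {f g h : (Fin n → ℝ) → ℝ≥0∞} (hf : Measurable f)
    (hg : Measurable g) (hh : Measurable h)
    (H : ∀ x y, f x * g y ≤ h ((2 : ℝ)⁻¹ • (x + y)) ^ 2) :
    (∫⁻ x, f x) * ∫⁻ x, g x ≤ (∫⁻ x, h x) ^ 2 := by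
  induction n with
  | zero =>
    rw [Measure.volume_pi_eq_dirac 0, lintegral_dirac, lintegral_dirac, lintegral_dirac]
    simpa using H 0 0
  | succ n ih =>
    have e := (volume_preserving_piFinSuccAbove (fun _ : Fin (n + 1) => ℝ) 0).symm
    set φ := (MeasurableEquiv.piFinSuccAbove (fun _ : Fin (n + 1) => ℝ) 0).symm with hφ
    have hsplit : ∀ u : (Fin (n + 1) → ℝ) → ℝ≥0∞, Measurable u →
        ∫⁻ x, u x = ∫⁻ t : ℝ, ∫⁻ z : Fin n → ℝ, u (φ (t, z)) := by
      intro u hu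
      rw [← e.lintegral_comp hu, Measure.volume_eq_prod,
        lintegral_prod (fun p => u (φ p)) (hu.comp φ.measurable).aemeasurable]
    have hmeas : ∀ u : (Fin (n + 1) → ℝ) → ℝ≥0∞, Measurable u →
        Measurable fun t : ℝ => ∫⁻ z : Fin n → ℝ, u (φ (t, z)) := fun u hu =>
      (hu.comp φ.measurable).lintegral_prod_right'
    have hsec : ∀ u : (Fin (n + 1) → ℝ) → ℝ≥0∞, Measurable u → ∀ t : ℝ,
        Measurable fun z : Fin n → ℝ => u (φ (t, z)) := fun u hu t =>
      hu.comp (φ.measurable.comp measurable_prodMk_left)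
    rw [hsplit f hf, hsplit g hg, hsplit h hh]
    refine lintegral_mul_lintegral_le_sq (hmeas f hf) (hmeas g hg) (hmeas h hh) fun s t => ?_
    refine ih (hsec f hf s) (hsec g hg t) (hsec h hh _) fun x y => ?_
    convert H (φ (s, x)) (φ (t, y)) using 3
    ext i
    refine Fin.cases ?_ (fun j => ?_) i
    · simp [hφ]; ring
    · simp [hφ]; ring

/-- The multiplicative Brunn–Minkowski inequality for midpoints. -/
lemma volume_mul_volume_le_sq {n : ℕ} {A B C : Set (EuclideanSpace ℝ (Fin n))}
    (hA : MeasurableSet A) (hB : MeasurableSet B) (hC : MeasurableSet C)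
    (h : ∀ x ∈ A, ∀ y ∈ B, (2 : ℝ)⁻¹ • (x + y) ∈ C) :
    volume A * volume B ≤ volume C ^ 2 := by
  have e := PiLp.volume_preserving_toLp (Fin n)
  have hv : ∀ S : Set (EuclideanSpace ℝ (Fin n)), MeasurableSet S →
      volume S = ∫⁻ x : Fin n → ℝ, S.indicator 1 (WithLp.toLp 2 x) := by
    intro S hS
    rw [e.lintegral_comp (measurable_one.indicator hS), lintegral_indicator_one hS]
  have hm : ∀ S : Set (EuclideanSpace ℝ (Fin n)), MeasurableSet S →
      Measurable fun x : Fin n → ℝ => (S.indicator 1 (WithLp.toLp 2 x) : ℝ≥0∞) := fun S hS =>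
    (measurable_one.indicator hS).comp e.measurable
  rw [hv A hA, hv B hB, hv C hC]
  refine lintegral_mul_lintegral_le_sq_pi n (hm A hA) (hm B hB) (hm C hC) fun x y => ?_
  by_cases hx : WithLp.toLp 2 x ∈ A
  · by_cases hy : WithLp.toLp 2 y ∈ B
    · have := h _ hx _ hy
      rw [← WithLp.toLp_add, ← WithLp.toLp_smul] at this
      rw [Set.indicator_of_mem hx, Set.indicator_of_mem hy, Set.indicator_of_mem this]
      simp
    · simp [hy]
  · simp [hx]
end PrekopaLeindler

section ConvexBody

variable {E : Type*} [NormedAddCommGroup E] [NormedSpace ℝ E] {K : Set E}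

lemma IsSymmConvexBody.neg_mem (hK : IsSymmConvexBody K) {x : E} (hx : x ∈ K) : -x ∈ K := by
  rw [hK.2.2.2]
  simpa using hx

lemma IsSymmConvexBody.mem_nhds_zero (hK : IsSymmConvexBody K) : K ∈ nhds (0 : E) := by
  obtain ⟨x, hx⟩ := hK.2.2.1
  have hx' : -x ∈ interior K := by
    rw [hK.2.2.2, ← Set.image_neg_eq_neg]
    have h := (Homeomorph.neg E).image_interior K
    rw [Homeomorph.coe_neg] at h
    exact h ▸ Set.mem_image_of_mem _ hx
  have := hK.2.1.interior hx hx' (a := 2⁻¹) (b := 2⁻¹) (by norm_num) (by norm_num) (by norm_num)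
  rw [mem_interior_iff_mem_nhds] at this
  simpa using this

lemma IsSymmConvexBody.gauge_le_iff (hK : IsSymmConvexBody K) {x : E} {r : ℝ} (hr : 0 < r) :
    gauge K x ≤ r ↔ ∃ y ∈ K, x = r • y := by
  have h : gauge K x ≤ r ↔ r⁻¹ • x ∈ K := by
    rw [← hK.1.isClosed.closure_eq, ← gauge_le_one_iff_mem_closure hK.2.1 hK.mem_nhds_zero,
      hK.1.isClosed.closure_eq, gauge_smul_of_nonneg (inv_nonneg.2 hr.le), smul_eq_mul,
      inv_mul_le_iff₀ hr, mul_one]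
  rw [h]
  constructor
  · intro hx
    exact ⟨_, hx, by rw [smul_inv_smul₀ hr.ne']⟩
  · rintro ⟨y, hy, rfl⟩
    rwa [inv_smul_smul₀ hr.ne']

lemma IsSymmConvexBody.exists_mem_eq_gauge_smul (hK : IsSymmConvexBody K) (x : E) :
    ∃ y ∈ K, x = gauge K x • y := by
  rcases (gauge_nonneg (s := K) x).eq_or_lt with h | h
  · have hx : x = 0 := (gauge_eq_zero (absorbent_nhds_zero hK.mem_nhds_zero)
      (NormedSpace.isVonNBounded_of_isBounded ℝ hK.1.isBounded)).1 h.symm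
    exact ⟨0, mem_of_mem_nhds hK.mem_nhds_zero, by simp [hx]⟩
  · exact (hK.gauge_le_iff h).1 le_rfl

lemma IsTwoConvex.gauge_midpoint_le (hK : IsSymmConvexBody K) {α : ℝ} (hα : IsTwoConvex K α)
    {x y : E} (hx : x ∈ K) (hy : y ∈ K) {ε : ℝ} (hε : 0 < ε) (hε2 : ε ≤ 2)
    (hxy : ε ≤ gauge K (x - y)) :
    gauge K ((2 : ℝ)⁻¹ • (x + y)) ≤ 1 - α * ε ^ 2 := by
  have hbdd : BddBelow { d | ∃ x y : E, gauge K x ≤ 1 ∧ gauge K y ≤ 1 ∧ ε ≤ gauge K (x - y) ∧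
      d = 1 - gauge K ((2:ℝ)⁻¹ • (x + y)) } := by
    refine ⟨0, ?_⟩
    rintro _ ⟨u, v, hu, hv, -, rfl⟩
    have h := gauge_add_le hK.2.1 (absorbent_nhds_zero hK.mem_nhds_zero) u v
    rw [gauge_smul_of_nonneg (by norm_num), smul_eq_mul]
    linarith
  have h := (hα ε hε hε2).trans (csInf_le hbdd
    ⟨x, y, gauge_le_one_of_mem hx, gauge_le_one_of_mem hy, hxy, rfl⟩)
  linarith

end ConvexBody

section DualNorm

variable {n : ℕ} {K : Set (EuclideanSpace ℝ (Fin n))}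

lemma IsSymmConvexBody.inner_le_dualNorm (hK : IsSymmConvexBody K)
    (θ : EuclideanSpace ℝ (Fin n)) {x : EuclideanSpace ℝ (Fin n)} (hx : x ∈ K) :
    ⟪θ, x⟫ ≤ dualNorm K θ :=
  le_csSup (hK.1.image (by fun_prop)).bddAbove ⟨x, hx, rfl⟩

lemma IsSymmConvexBody.abs_inner_le_dualNorm (hK : IsSymmConvexBody K)
    (θ : EuclideanSpace ℝ (Fin n)) {x : EuclideanSpace ℝ (Fin n)} (hx : x ∈ K) :
    |⟪θ, x⟫| ≤ dualNorm K θ := by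
  have h := hK.inner_le_dualNorm θ (hK.neg_mem hx)
  rw [inner_neg_right] at h
  exact abs_le.2 ⟨by linarith, hK.inner_le_dualNorm θ hx⟩

lemma IsSymmConvexBody.dualNorm_nonneg (hK : IsSymmConvexBody K)
    (θ : EuclideanSpace ℝ (Fin n)) : 0 ≤ dualNorm K θ := by
  simpa using hK.inner_le_dualNorm θ (mem_of_mem_nhds hK.mem_nhds_zero)

lemma IsSymmConvexBody.inner_le_gauge_mul_dualNorm (hK : IsSymmConvexBody K)
    (θ x : EuclideanSpace ℝ (Fin n)) : ⟪θ, x⟫ ≤ gauge K x * dualNorm K θ := by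
  obtain ⟨y, hy, hxy⟩ := hK.exists_mem_eq_gauge_smul x
  calc ⟪θ, x⟫ = gauge K x * ⟪θ, y⟫ := by
        conv_lhs => rw [hxy, real_inner_smul_right]
    _ ≤ _ := mul_le_mul_of_nonneg_left (hK.inner_le_dualNorm θ hy) (gauge_nonneg _)

lemma IsSymmConvexBody.continuous_dualNorm (hK : IsSymmConvexBody K) :
    Continuous (dualNorm K) := by
  obtain ⟨R, hR⟩ := hK.1.isBounded.exists_norm_le
  have hR0 : 0 ≤ R := (norm_nonneg _).trans (hR 0 (mem_of_mem_nhds hK.mem_nhds_zero))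
  refine (LipschitzWith.of_le_add_mul R.toNNReal fun θ η => ?_).continuous
  refine csSup_le (Set.Nonempty.image _ ⟨0, mem_of_mem_nhds hK.mem_nhds_zero⟩) ?_
  rintro _ ⟨x, hx, rfl⟩
  have h1 := hK.inner_le_dualNorm η hx
  have h2 := (real_inner_le_norm (θ - η) x).trans
    (mul_le_mul_of_nonneg_left (hR x hx) (norm_nonneg _))
  rw [inner_sub_left] at h2
  rw [Real.coe_toNNReal R hR0, dist_eq_norm]
  simp only
  linarith

open scoped Pointwise in
/-- Concentration on a 2-convex body: the caps cut off by a hyperplane have small volume. -/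
lemma IsTwoConvex.volume_cap_le (hK : IsSymmConvexBody K) (hv : volume K = 1) {α : ℝ}
    (hα : IsTwoConvex K α) (θ : EuclideanSpace ℝ (Fin n)) {t : ℝ} (ht : 0 < t) :
    volume {x ∈ K | t ≤ ⟪θ, x⟫} ≤
      ENNReal.ofReal (Real.exp (-(4 * n * α / dualNorm K θ ^ 2) * t ^ 2)) := by
  set w := dualNorm K θ with hw
  set A := {x ∈ K | t ≤ ⟪θ, x⟫} with hA
  rcases A.eq_empty_or_nonempty with h0 | ⟨x₀, hx₀⟩
  · simp [h0]
  have htw : t ≤ w := hx₀.2.trans (hK.inner_le_dualNorm θ hx₀.1)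
  have hw0 : 0 < w := ht.trans_le htw
  set ε := 2 * t / w with hε
  have hε0 : 0 < ε := by positivity
  have hε2 : ε ≤ 2 := by rw [hε, div_le_iff₀ hw0]; linarith
  set r := 1 - α * ε ^ 2 with hr
  have hmid : ∀ x ∈ A, ∀ y ∈ -A, (2 : ℝ)⁻¹ • (x + y) ∈ r • K ∧ 0 ≤ r := by
    intro x hx y hy
    have hy1 : y ∈ K := by simpa using hK.neg_mem hy.1
    have hy2 : t ≤ -⟪θ, y⟫ := by simpa using hy.2
    have hg : ε ≤ gauge K (x - y) := by
      have h := hK.inner_le_gauge_mul_dualNorm θ (x - y)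
      rw [inner_sub_right, ← hw] at h
      rw [hε, div_le_iff₀ hw0]
      linarith [hx.2]
    have h := hα.gauge_midpoint_le hK hx.1 hy1 hε0 hε2 hg
    obtain ⟨z, hz, hz'⟩ := hK.exists_mem_eq_gauge_smul ((2 : ℝ)⁻¹ • (x + y))
    have hr0 : 0 ≤ r := (gauge_nonneg _).trans h
    refine ⟨?_, hr0⟩
    rcases hr0.eq_or_lt with h0 | h0
    · have hg0 : gauge K ((2 : ℝ)⁻¹ • (x + y)) = 0 :=
        le_antisymm (h.trans_eq h0.symm) (gauge_nonneg _)
      rw [hg0, zero_smul] at hz'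
      exact ⟨z, hz, by rw [hz', ← h0]; simp⟩
    · obtain ⟨u, hu, hu'⟩ := (hK.gauge_le_iff h0).1 h
      exact ⟨u, hu, hu'.symm⟩
  have hcl : IsClosed {x | t ≤ ⟪θ, x⟫} := isClosed_le (by fun_prop) (by fun_prop)
  have hAm : MeasurableSet A := (hK.1.isClosed.inter hcl).measurableSet
  have hr0 : 0 ≤ r := (hmid x₀ hx₀ (-x₀) (by simpa using hx₀)).2
  have key := volume_mul_volume_le_sq hAm hAm.neg (hK.1.smul r).measurableSet
    fun x hx y hy => (hmid x hx y hy).1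
  rw [Measure.measure_neg, Measure.addHaar_smul_of_nonneg _ hr0, hv, mul_one,
    finrank_euclideanSpace_fin, ← sq] at key
  have hle : volume A ≤ ENNReal.ofReal (r ^ n) :=
    (ENNReal.pow_le_pow_left_iff two_ne_zero).1 key
  refine hle.trans (ENNReal.ofReal_le_ofReal ?_)
  calc r ^ n ≤ Real.exp (-(α * ε ^ 2)) ^ n :=
        pow_le_pow_left₀ hr0 (Real.one_sub_le_exp_neg _) n
    _ = _ := by
        rw [← Real.exp_nat_mul]
        congr 1
        rw [hε]
        field_simp
        ring

lemma IsTwoConvex.integral_abs_inner_le (hn : 0 < n) (hK : IsSymmConvexBody K)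
    (hv : volume K = 1) {α : ℝ} (hα0 : 0 < α) (hα : IsTwoConvex K α)
    (θ : EuclideanSpace ℝ (Fin n)) :
    ∫ x in K, |⟪θ, x⟫| ≤ dualNorm K θ / Real.sqrt (n * α) := by
  rcases (hK.dualNorm_nonneg θ).eq_or_lt with hw | hw
  · rw [← hw, zero_div, setIntegral_congr_fun (g := fun _ => (0 : ℝ)) hK.1.measurableSet]
    · simp
    · intro x hx
      exact le_antisymm ((hK.abs_inner_le_dualNorm θ hx).trans_eq hw.symm) (abs_nonneg _)
  set w := dualNorm K θ
  have hn' : (0 : ℝ) < n := by exact_mod_cast hn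
  set b := 4 * n * α / w ^ 2 with hb
  have hb0 : 0 < b := by positivity
  have hint : Integrable (fun x => |⟪θ, x⟫|) (volume.restrict K) :=
    (Continuous.continuousOn (by fun_prop)).integrableOn_compact hK.1
  rw [hint.integral_eq_integral_meas_le (Filter.Eventually.of_forall fun x => abs_nonneg _)]
  have htail : ∀ t ∈ Set.Ioi (0 : ℝ),
      (volume.restrict K).real {x | t ≤ |⟪θ, x⟫|} ≤ 2 * Real.exp (-b * t ^ 2) := by
    intro t ht
    have hsub : {x | t ≤ |⟪θ, x⟫|} ∩ K ⊆ {x ∈ K | t ≤ ⟪θ, x⟫} ∪ -{x ∈ K | t ≤ ⟪θ, x⟫} := by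
      rintro x ⟨hx, hxK⟩
      rcases le_abs.1 (Set.mem_ofPred_eq ▸ hx) with h | h
      · exact Or.inl ⟨hxK, h⟩
      · exact Or.inr ⟨hK.neg_mem hxK, by rwa [inner_neg_right]⟩
    have hcap := hα.volume_cap_le hK hv θ ht
    rw [measureReal_def, Measure.restrict_apply
      (measurableSet_le measurable_const (by fun_prop))]
    refine ENNReal.toReal_le_of_le_ofReal (by positivity) ?_
    refine (measure_mono hsub).trans ((measure_union_le _ _).trans ?_)
    rw [Measure.measure_neg, two_mul, ENNReal.ofReal_add (by positivity) (by positivity)]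
    exact add_le_add hcap hcap
  refine (integral_mono_of_nonneg (Filter.Eventually.of_forall fun t => measureReal_nonneg)
    ((integrable_exp_neg_mul_sq hb0).const_mul 2).integrableOn
    ((ae_restrict_iff' measurableSet_Ioi).2 (Filter.Eventually.of_forall htail))).trans ?_
  rw [integral_const_mul, integral_gaussian_Ioi, mul_div_cancel₀ _ two_ne_zero]
  rw [Real.sqrt_le_left (by positivity), div_pow, Real.sq_sqrt (by positivity), hb, div_div_eq_mul_div,
    div_le_div_iff₀ (by positivity) (by positivity)]
  have : 0 ≤ (4 - Real.pi) * (w ^ 2 * (n * α)) :=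
    mul_nonneg (by linarith [Real.pi_le_four]) (by positivity)
  linarith

end DualNorm

section Sphere

open scoped ENNReal

lemma lipschitzOnWith_normalize (E : Type*) [NormedAddCommGroup E] [NormedSpace ℝ E] :
    LipschitzOnWith 2 (fun v : E => ‖v‖⁻¹ • v) {v | 1 ≤ ‖v‖} := by
  refine LipschitzOnWith.of_dist_le_mul fun v hv w hw => ?_
  have hv : 1 ≤ ‖v‖ := hv
  have hw : 1 ≤ ‖w‖ := hw
  have hv0 : 0 < ‖v‖ := by linarith
  have hw0 : 0 < ‖w‖ := by linarith
  have h1 : ‖v‖⁻¹ • v - ‖w‖⁻¹ • w = ‖v‖⁻¹ • (v - w) + (‖v‖⁻¹ - ‖w‖⁻¹) • w := by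
    rw [smul_sub, sub_smul]; abel
  have h2 : ‖(‖v‖⁻¹ - ‖w‖⁻¹) • w‖ ≤ ‖v‖⁻¹ * ‖v - w‖ := by
    have h3 : ‖v‖⁻¹ - ‖w‖⁻¹ = ‖v‖⁻¹ * (‖w‖ - ‖v‖) * ‖w‖⁻¹ := by field_simp
    rw [norm_smul, h3, norm_mul, norm_mul, norm_inv, norm_inv, norm_norm, norm_norm,
      mul_assoc, inv_mul_cancel₀ hw0.ne', mul_one, Real.norm_eq_abs]
    rw [norm_sub_rev]
    exact mul_le_mul_of_nonneg_left (abs_norm_sub_norm_le w v) (by positivity)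
  have h4 : ‖v‖⁻¹ * ‖v - w‖ ≤ ‖v - w‖ :=
    mul_le_of_le_one_left (norm_nonneg _) (inv_le_one_of_one_le₀ hv)
  rw [dist_eq_norm, dist_eq_norm, h1]
  refine (norm_add_le _ _).trans ?_
  rw [norm_smul, norm_inv, norm_norm, NNReal.coe_ofNat]
  linarith

lemma lipschitzWith_insertNth {m : ℕ} (i : Fin (m + 1)) (s : ℝ) :
    LipschitzWith 1 (fun z : Fin m → ℝ => (i.insertNth s z : Fin (m + 1) → ℝ)) := by
  refine LipschitzWith.of_dist_le_mul fun z w => ?_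
  rw [NNReal.coe_one, one_mul, dist_pi_le_iff dist_nonneg]
  refine fun j => Fin.succAboveCases i ?_ (fun k => ?_) j
  · simp
  · simpa using dist_le_pi_dist z w k

lemma hausdorffMeasure_sphere_ne_top (m : ℕ) :
    μH[(m : ℝ)] (Metric.sphere (0 : EuclideanSpace ℝ (Fin (m + 1))) 1) ≠ ∞ := by
  let f : Fin (m + 1) → ℝ → (Fin m → ℝ) → EuclideanSpace ℝ (Fin (m + 1)) := fun i s z =>
    ‖WithLp.toLp 2 (i.insertNth s z : Fin (m + 1) → ℝ)‖⁻¹ •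
      WithLp.toLp 2 (i.insertNth s z : Fin (m + 1) → ℝ)
  have hvol : μH[(m : ℝ)] (Metric.closedBall (0 : Fin m → ℝ) 1) ≠ ∞ := by
    have h := hausdorffMeasure_pi_real (ι := Fin m)
    rw [Fintype.card_fin] at h
    rw [h]
    exact (isCompact_closedBall _ _).measure_lt_top.ne
  have hpatch : ∀ i s, |s| = 1 → μH[(m : ℝ)] (f i s '' Metric.closedBall 0 1) ≠ ∞ := by
    intro i s hs
    have hmaps : Set.MapsTo (fun z : Fin m → ℝ =>
        WithLp.toLp 2 (i.insertNth s z : Fin (m + 1) → ℝ)) (Metric.closedBall 0 1)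
        {v : EuclideanSpace ℝ (Fin (m + 1)) | 1 ≤ ‖v‖} := by
      intro z _
      have h := PiLp.norm_apply_le
        (WithLp.toLp 2 (i.insertNth s z : Fin (m + 1) → ℝ) : EuclideanSpace ℝ (Fin (m + 1))) i
      simpa [hs] using h
    have hL := (lipschitzOnWith_normalize (EuclideanSpace ℝ (Fin (m + 1)))).comp
      ((PiLp.lipschitzWith_toLp 2 (fun _ : Fin (m + 1) => ℝ)).comp
        (lipschitzWith_insertNth i s)).lipschitzOnWith hmaps
    refine ne_top_of_le_ne_top ?_ (hL.hausdorffMeasure_image_le (Nat.cast_nonneg m))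
    exact ENNReal.mul_ne_top (ENNReal.rpow_ne_top_of_nonneg (Nat.cast_nonneg m) ENNReal.coe_ne_top) hvol
  have hcover : Metric.sphere (0 : EuclideanSpace ℝ (Fin (m + 1))) 1 ⊆
      ⋃ i, (f i 1 '' Metric.closedBall 0 1) ∪ (f i (-1) '' Metric.closedBall 0 1) := by
    intro x hx
    obtain ⟨i, hi⟩ := Finite.exists_max fun i => |x i|
    have hx1 : ‖x‖ = 1 := by simpa using hx
    have hxi : x i ≠ 0 := by
      intro h0
      have : x = 0 := by
        ext j
        have := hi j
        rw [h0, abs_zero] at this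
        simpa using this
      simp [this] at hx1
    have hpos : 0 < |x i| := abs_pos.2 hxi
    have hz : (fun j => |x i|⁻¹ * x (i.succAbove j)) ∈ Metric.closedBall (0 : Fin m → ℝ) 1 := by
      rw [mem_closedBall_zero_iff, pi_norm_le_iff_of_nonneg zero_le_one]
      intro j
      rw [Real.norm_eq_abs, abs_mul, abs_inv, abs_abs, inv_mul_le_iff₀ hpos, mul_one]
      exact hi _
    have hfx : ∀ s, s = |x i|⁻¹ * x i → f i s (fun j => |x i|⁻¹ * x (i.succAbove j)) = x := by
      intro s hs
      have hv : WithLp.toLp 2 (i.insertNth s (fun j => |x i|⁻¹ * x (i.succAbove j)) :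
          Fin (m + 1) → ℝ) = |x i|⁻¹ • x := by
        ext j
        refine Fin.succAboveCases i ?_ (fun k => ?_) j
        · simp [hs]
        · simp
      simp only [f, hv]
      rw [norm_smul, hx1, norm_inv, Real.norm_eq_abs, abs_abs, mul_one, inv_inv, smul_inv_smul₀ hpos.ne']
    refine Set.mem_iUnion.2 ⟨i, ?_⟩
    rcases lt_or_gt_of_ne hxi with h | h
    · exact Or.inr ⟨_, hz, hfx _ (by rw [abs_of_neg h]; field_simp)⟩
    · exact Or.inl ⟨_, hz, hfx _ (by rw [abs_of_pos h]; field_simp)⟩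
  refine ne_top_of_le_ne_top ?_ ((measure_mono hcover).trans (measure_iUnion_le _))
  rw [tsum_fintype]
  refine ENNReal.sum_ne_top.2 fun i _ => ?_
  exact ne_top_of_le_ne_top (ENNReal.add_ne_top.2
    ⟨hpatch i 1 (by simp), hpatch i (-1) (by simp)⟩) (measure_union_le _ _)

lemma hausdorffMeasure_sphere_ne_zero (m : ℕ) :
    μH[(m : ℝ)] (Metric.sphere (0 : EuclideanSpace ℝ (Fin (m + 1))) 1) ≠ 0 := by
  intro h0
  let P : EuclideanSpace ℝ (Fin (m + 1)) → Fin m → ℝ := fun x j => x j.succ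
  have hP : LipschitzWith 1 P := by
    refine LipschitzWith.of_dist_le_mul fun x y => ?_
    rw [NNReal.coe_one, one_mul, dist_pi_le_iff dist_nonneg]
    intro j
    rw [dist_eq_norm, dist_eq_norm]
    exact PiLp.norm_apply_le (x - y) j.succ
  have h1 := hP.hausdorffMeasure_image_le (Nat.cast_nonneg m)
    (Metric.sphere (0 : EuclideanSpace ℝ (Fin (m + 1))) 1)
  have hcard := hausdorffMeasure_pi_real (ι := Fin m)
  rw [Fintype.card_fin] at hcard
  rw [h0, mul_zero, hcard] at h1
  have hopen : IsOpen {y : Fin m → ℝ | ∑ j, y j ^ 2 < 1} :=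
    isOpen_lt (by fun_prop) continuous_const
  have hpos : 0 < volume {y : Fin m → ℝ | ∑ j, y j ^ 2 < 1} :=
    hopen.measure_pos _ ⟨0, by simp⟩
  have hsub : {y : Fin m → ℝ | ∑ j, y j ^ 2 < 1} ⊆
      P '' Metric.sphere (0 : EuclideanSpace ℝ (Fin (m + 1))) 1 := by
    intro y hy
    have hy : ∑ j, y j ^ 2 < 1 := hy
    refine ⟨WithLp.toLp 2 (Fin.cons (Real.sqrt (1 - ∑ j, y j ^ 2)) y), ?_, ?_⟩
    · rw [mem_sphere_zero_iff_norm, EuclideanSpace.norm_eq, Fin.sum_univ_succ]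
      simp only [Fin.cons_zero, Fin.cons_succ, Real.norm_eq_abs, sq_abs]
      rw [Real.sq_sqrt (by linarith)]
      simp
    · ext j
      simp [P]
  exact absurd ((measure_mono hsub).trans h1) (not_le.2 hpos)

variable {n : ℕ}

lemma isProbabilityMeasure_sphereMeasure (hn : 0 < n) :
    IsProbabilityMeasure (sphereMeasure n) := by
  obtain ⟨m, rfl⟩ := Nat.exists_eq_succ_of_ne_zero hn.ne'
  have hd : ((m.succ : ℕ) : ℝ) - 1 = m := by simp
  refine ⟨?_⟩
  rw [sphereMeasure, hd, Measure.smul_apply, Measure.restrict_apply_univ, smul_eq_mul]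
  exact ENNReal.inv_mul_cancel (hausdorffMeasure_sphere_ne_zero m)
    (hausdorffMeasure_sphere_ne_top m)

lemma ae_norm_eq_one_sphereMeasure (n : ℕ) : ∀ᵐ θ ∂sphereMeasure n, ‖θ‖ = 1 := by
  refine Measure.ae_smul_measure ?_ _
  filter_upwards [ae_restrict_mem Metric.isClosed_sphere.measurableSet] with θ hθ
  simpa using hθ

lemma integrable_sphereMeasure_of_continuous (hn : 0 < n) {f : EuclideanSpace ℝ (Fin n) → ℝ}
    (hf : Continuous f) : Integrable f (sphereMeasure n) := by
  have := isProbabilityMeasure_sphereMeasure hn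
  obtain ⟨B, hB⟩ := (isCompact_sphere (0 : EuclideanSpace ℝ (Fin n)) 1).exists_bound_of_continuousOn
    hf.continuousOn
  refine Integrable.of_bound hf.aestronglyMeasurable B ?_
  filter_upwards [ae_norm_eq_one_sphereMeasure n] with θ hθ
  exact hB θ (by simpa using hθ)

lemma measurePreserving_sphereMeasure
    (e : EuclideanSpace ℝ (Fin n) ≃ₗᵢ[ℝ] EuclideanSpace ℝ (Fin n)) :
    MeasurePreserving e (sphereMeasure n) (sphereMeasure n) := by
  have h := (e.toIsometryEquiv.measurePreserving_hausdorffMeasure ((n : ℝ) - 1)).restrict_preimage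
    (s := Metric.sphere (0 : EuclideanSpace ℝ (Fin n)) 1) Metric.isClosed_sphere.measurableSet
  have hs : e.toIsometryEquiv ⁻¹' Metric.sphere (0 : EuclideanSpace ℝ (Fin n)) 1 =
      Metric.sphere 0 1 := by
    ext x; simp
  rw [hs] at h
  exact h.smul_measure _

lemma integral_comp_inner_sphereMeasure (i : Fin n) (φ : ℝ → ℝ) (x : EuclideanSpace ℝ (Fin n)) :
    ∫ θ, φ ⟪θ, x⟫ ∂sphereMeasure n = ∫ θ, φ (‖x‖ * θ i) ∂sphereMeasure n := by
  set y : EuclideanSpace ℝ (Fin n) := ‖x‖ • EuclideanSpace.single i 1 with hy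
  have hxy : ‖y‖ = ‖x‖ := by simp [hy, norm_smul]
  set e := (ℝ ∙ (y - x))ᗮ.reflection
  have he : e y = x := Submodule.reflection_sub hxy
  rw [← (measurePreserving_sphereMeasure e).integral_comp
    e.toHomeomorph.measurableEmbedding (fun θ => φ ⟪θ, x⟫)]
  refine integral_congr_ae (Filter.Eventually.of_forall fun θ => ?_)
  simp only
  conv_lhs => rw [← he, LinearIsometryEquiv.inner_map_map]
  simp [hy, real_inner_smul_right, EuclideanSpace.inner_single_right]

lemma integral_sq_sphereMeasure (hn : 0 < n) (i : Fin n) :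
    ∫ θ, θ i ^ 2 ∂sphereMeasure n = 1 / n := by
  have := isProbabilityMeasure_sphereMeasure hn
  have hint : ∀ j : Fin n, Integrable (fun θ : EuclideanSpace ℝ (Fin n) => θ j ^ 2)
      (sphereMeasure n) := fun j => integrable_sphereMeasure_of_continuous hn (by fun_prop)
  have hj : ∀ j : Fin n, ∫ θ, θ j ^ 2 ∂sphereMeasure n = ∫ θ, θ i ^ 2 ∂sphereMeasure n := by
    intro j
    simpa [EuclideanSpace.inner_single_right] using
      integral_comp_inner_sphereMeasure i (fun t => t ^ 2) (EuclideanSpace.single j 1)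
  have hsum : ∑ j : Fin n, ∫ θ, θ j ^ 2 ∂sphereMeasure n = 1 := by
    rw [← integral_finsetSum _ fun j _ => hint j]
    rw [integral_congr_ae (g := fun _ => (1 : ℝ))]
    · simp
    · filter_upwards [ae_norm_eq_one_sphereMeasure n] with θ hθ
      rw [← EuclideanSpace.real_norm_sq_eq, hθ, one_pow]
  simp only [hj, Finset.sum_const, Finset.card_univ, Fintype.card_fin, nsmul_eq_mul] at hsum
  rw [eq_div_iff (by positivity)]
  linarith

lemma integral_pow_four_le_integral_sq_mul_sq (hn : 0 < n) (k i j : Fin n) :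
    (∫ θ, θ k ^ 4 ∂sphereMeasure n) / 3 ≤ ∫ θ, θ i ^ 2 * θ j ^ 2 ∂sphereMeasure n := by
  set a := ∫ θ, θ k ^ 4 ∂sphereMeasure n with ha
  have hx : ∀ x : EuclideanSpace ℝ (Fin n), ∫ θ, ⟪θ, x⟫ ^ 4 ∂sphereMeasure n = ‖x‖ ^ 4 * a := by
    intro x
    rw [integral_comp_inner_sphereMeasure k (fun t => t ^ 4) x, ha, ← integral_const_mul]
    simp only [mul_pow]
  have hint : ∀ f : EuclideanSpace ℝ (Fin n) → ℝ, Continuous f → Integrable f (sphereMeasure n) :=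
    fun f hf => integrable_sphereMeasure_of_continuous hn hf
  have hi : ∀ i : Fin n, ∫ θ, θ i ^ 4 ∂sphereMeasure n = a := by
    intro i
    simpa [EuclideanSpace.inner_single_right] using hx (EuclideanSpace.single i 1)
  rcases eq_or_ne i j with rfl | hij
  · have ha0 : 0 ≤ a := integral_nonneg fun θ => by positivity
    have : ∫ θ, θ i ^ 2 * θ i ^ 2 ∂sphereMeasure n = a := by
      rw [← hi i]; congr 1; ext θ; ring
    linarith
  · set u : EuclideanSpace ℝ (Fin n) := EuclideanSpace.single i 1
    set v : EuclideanSpace ℝ (Fin n) := EuclideanSpace.single j 1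
    have huv : ⟪u, v⟫ = 0 := by
      simp [u, v, EuclideanSpace.inner_single_left, hij]
    have hu : ‖u‖ = 1 := by simp [u]
    have hv : ‖v‖ = 1 := by simp [v]
    have hp : ‖u + v‖ ^ 4 = 4 := by
      have : ‖u + v‖ ^ 2 = 2 := by rw [norm_add_sq_real, huv, hu, hv]; norm_num
      rw [show ‖u + v‖ ^ 4 = (‖u + v‖ ^ 2) ^ 2 by ring, this]; norm_num
    have hm : ‖u - v‖ ^ 4 = 4 := by
      have : ‖u - v‖ ^ 2 = 2 := by rw [norm_sub_sq_real, huv, hu, hv]; norm_num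
      rw [show ‖u - v‖ ^ 4 = (‖u - v‖ ^ 2) ^ 2 by ring, this]; norm_num
    have h1 := hx (u + v)
    have h2 := hx (u - v)
    rw [hp] at h1
    rw [hm] at h2
    have h3 : ∫ θ, (⟪θ, u + v⟫ ^ 4 + ⟪θ, u - v⟫ ^ 4) ∂sphereMeasure n =
        ∫ θ, (2 * θ i ^ 4 + 2 * θ j ^ 4 + 12 * (θ i ^ 2 * θ j ^ 2)) ∂sphereMeasure n := by
      congr 1
      ext θ
      have hui : ⟪θ, u⟫ = θ i := by simp [u, EuclideanSpace.inner_single_right]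
      have hvj : ⟪θ, v⟫ = θ j := by simp [v, EuclideanSpace.inner_single_right]
      rw [inner_add_right, inner_sub_right, hui, hvj]
      ring
    rw [integral_add (hint _ (by fun_prop)) (hint _ (by fun_prop)), h1, h2,
      integral_add (hint _ (by fun_prop)) (hint _ (by fun_prop)),
      integral_add (hint _ (by fun_prop)) (hint _ (by fun_prop)), integral_const_mul,
      integral_const_mul, integral_const_mul, hi, hi] at h3
    linarith

lemma integral_pow_four_sphereMeasure_le (hn : 0 < n) (k : Fin n) :
    ∫ θ, θ k ^ 4 ∂sphereMeasure n ≤ 3 / (n : ℝ) ^ 2 := by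
  have := isProbabilityMeasure_sphereMeasure hn
  have hint : ∀ i j : Fin n, Integrable (fun θ : EuclideanSpace ℝ (Fin n) => θ i ^ 2 * θ j ^ 2)
      (sphereMeasure n) := fun i j => integrable_sphereMeasure_of_continuous hn (by fun_prop)
  have hsum : ∑ i : Fin n, ∑ j : Fin n, ∫ θ, θ i ^ 2 * θ j ^ 2 ∂sphereMeasure n = 1 := by
    simp_rw [← integral_finsetSum _ fun j _ => hint _ j]
    rw [← integral_finsetSum _ fun i _ => integrable_finsetSum _ fun j _ => hint i j]
    rw [integral_congr_ae (g := fun _ => (1 : ℝ))]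
    · simp
    · filter_upwards [ae_norm_eq_one_sphereMeasure n] with θ hθ
      simp_rw [← Finset.mul_sum, ← Finset.sum_mul]
      rw [← EuclideanSpace.real_norm_sq_eq, hθ]
      norm_num
  have hle := Finset.sum_le_sum fun i (_ : i ∈ Finset.univ) =>
    Finset.sum_le_sum fun j (_ : j ∈ Finset.univ) =>
      integral_pow_four_le_integral_sq_mul_sq hn k i j
  rw [hsum] at hle
  simp only [Finset.sum_const, Finset.card_univ, Fintype.card_fin, nsmul_eq_mul] at hle
  rw [le_div_iff₀ (by positivity)]
  linarith

lemma le_integral_abs_sphereMeasure (hn : 0 < n) (i : Fin n) :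
    1 / (8 * Real.sqrt n) ≤ ∫ θ, |θ i| ∂sphereMeasure n := by
  have hn' : (0 : ℝ) < n := by exact_mod_cast hn
  set l := Real.sqrt n / 2 with hl
  have hl0 : 0 < l := by positivity
  have hl2 : l ^ 2 = n / 4 := by rw [hl, div_pow, Real.sq_sqrt hn'.le]; norm_num
  have hint : ∀ f : EuclideanSpace ℝ (Fin n) → ℝ, Continuous f → Integrable f (sphereMeasure n) :=
    fun f hf => integrable_sphereMeasure_of_continuous hn hf
  have hpt : ∀ t : ℝ, l ^ 2 * t ^ 2 ≤ l * |t| + l ^ 4 * t ^ 4 := by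
    intro t
    have key : ∀ u : ℝ, 0 ≤ u → u ^ 2 ≤ u + u ^ 4 := by
      intro u hu
      rcases le_total u 1 with h | h
      · nlinarith [pow_nonneg hu 4]
      · nlinarith [pow_le_pow_right₀ h (show 2 ≤ 4 by norm_num)]
    have := key (l * |t|) (by positivity)
    rwa [mul_pow, mul_pow, sq_abs, show |t| ^ 4 = t ^ 4 from Even.pow_abs (by decide) t] at this
  have h := integral_mono (μ := sphereMeasure n) (hint (fun θ => l ^ 2 * θ i ^ 2) (by fun_prop))
    (hint (fun θ => l * |θ i| + l ^ 4 * θ i ^ 4) (by fun_prop)) fun θ => hpt (θ i)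
  rw [integral_add (hint _ (by fun_prop)) (hint _ (by fun_prop)), integral_const_mul,
    integral_const_mul, integral_const_mul, integral_sq_sphereMeasure hn i] at h
  have h4 := mul_le_mul_of_nonneg_left (integral_pow_four_sphereMeasure_le hn i)
    (pow_nonneg hl0.le 4)
  have e2 : l ^ 2 * (1 / n) = 1 / 4 := by rw [hl2]; field_simp
  have e4 : l ^ 4 * (3 / (n : ℝ) ^ 2) = 3 / 16 := by
    rw [show l ^ 4 = (l ^ 2) ^ 2 by ring, hl2]; field_simp; norm_num
  rw [e2] at h
  rw [e4] at h4
  have hs : Real.sqrt n = 2 * l := by rw [hl]; ring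
  rw [hs, div_le_iff₀ (by positivity)]
  linarith

end Sphere

theorem twoConvex_mean_norm_le_mean_width :
    ∃ C : ℝ, 0 < C ∧ ∀ (n : ℕ) (K : Set (EuclideanSpace ℝ (Fin n))) (α : ℝ),
      0 < n → IsSymmConvexBody K → volume K = 1 → 0 < α → IsTwoConvex K α →
      ∫ x in K, ‖x‖ ≤ C * MStar K / Real.sqrt α := by
  refine ⟨8, by norm_num, fun n K α hn hK hv hα0 hα => ?_⟩
  have := isProbabilityMeasure_sphereMeasure hn
  have : IsFiniteMeasure (volume.restrict K) := ⟨by simp [hv]⟩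
  have hn' : (0 : ℝ) < n := by exact_mod_cast hn
  set s := ∫ θ, |θ ⟨0, hn⟩| ∂sphereMeasure n with hs
  have hnorm : Integrable (fun x => ‖x‖) (volume.restrict K) :=
    continuous_norm.continuousOn.integrableOn_compact hK.1
  have hprod : Integrable (Function.uncurry fun θ x : EuclideanSpace ℝ (Fin n) => |⟪θ, x⟫|)
      ((sphereMeasure n).prod (volume.restrict K)) := by
    refine ((integrable_sphereMeasure_of_continuous hn continuous_norm).mul_prod hnorm).mono
      (Continuous.aestronglyMeasurable (by unfold Function.uncurry; fun_prop))
      (Filter.Eventually.of_forall fun p => ?_)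
    simpa [Function.uncurry] using abs_real_inner_le_norm p.1 p.2
  have hswap : ∫ θ, (∫ x in K, |⟪θ, x⟫|) ∂sphereMeasure n = (∫ x in K, ‖x‖) * s := by
    rw [integral_integral_swap hprod, ← integral_mul_const]
    congr 1
    ext x
    rw [integral_comp_inner_sphereMeasure ⟨0, hn⟩ (fun t => |t|) x, hs, ← integral_const_mul]
    simp only [abs_mul, abs_norm]
  have hle : ∫ θ, (∫ x in K, |⟪θ, x⟫|) ∂sphereMeasure n ≤ MStar K / Real.sqrt (n * α) := by
    rw [MStar, ← integral_div]
    exact integral_mono hprod.integral_prod_left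
      ((integrable_sphereMeasure_of_continuous hn hK.continuous_dualNorm).div_const _)
      fun θ => hα.integral_abs_inner_le hn hK hv hα0 θ
  rw [hswap] at hle
  have hI : 0 ≤ ∫ x in K, ‖x‖ := integral_nonneg fun x => norm_nonneg x
  have h := (mul_le_mul_of_nonneg_left (le_integral_abs_sphereMeasure hn ⟨0, hn⟩) hI).trans hle
  have hsn : 0 < Real.sqrt n := Real.sqrt_pos.2 hn'
  have hsα : 0 < Real.sqrt α := Real.sqrt_pos.2 hα0
  rw [Real.sqrt_mul hn'.le, mul_one_div, div_le_div_iff₀ (by positivity) (by positivity)] at h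
  rw [le_div_iff₀ hsα]
  refine le_of_mul_le_mul_right ?_ hsn
  linarith
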